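/- arXiv:2409.03310 — 2 statements merged into one kernel-verified Lean document; each statement's English description precedes it below -/
import Mathlib

section
/- Let (X,μ,f) be uniquely ergodic and suppose (X,μ,f^d) is not uniquely ergodic for some d ≥ 2. Then there exists a prime p dividing d such that (X,μ,f^p) is not uniquely ergodic. -/
open MeasureTheory Filter Topology Set
open scoped ENNReal NNReal

attribute [local instance] Matrix.normedAddCommGroup

noncomputable section

/-- The cocycle `A(n,x) = A(f^{n-1}x) ⋯ A(fx) A(x)` generated by a matrix-valued map `A`. -/
def cocycle {X : Type*} {m : ℕ} (f : X → X) (A : X → Matrix (Fin m) (Fin m) ℝ) :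
    ℕ → X → Matrix (Fin m) (Fin m) ℝ
  | 0, _ => 1
  | n + 1, x => A (f^[n] x) * cocycle f A n x

/-- `A` is a uniform cocycle over `f` if `(1/n) log ‖A(n,x)‖` converges uniformly on `X`. -/
def IsUniformCocycle {X : Type*} [TopologicalSpace X] {m : ℕ} (f : X → X)
    (A : X → Matrix (Fin m) (Fin m) ℝ) : Prop :=
  ∃ L : X → ℝ, TendstoUniformly (fun (n : ℕ) (x : X) => Real.log ‖cocycle f A n x‖ / n) L atTop

/-- `A` is a continuous map from `X` to `GL(m,ℝ)`. -/
def ContGL {X : Type*} [TopologicalSpace X] {m : ℕ} (A : X → Matrix (Fin m) (Fin m) ℝ) : Prop :=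
  Continuous A ∧ ∀ x, IsUnit (A x)

/-- `μ` is an `f`-invariant Borel probability measure. -/
def InvProb {X : Type*} [MeasurableSpace X] (f : X → X) (μ : Measure X) : Prop :=
  IsProbabilityMeasure μ ∧ μ.map f = μ

/-- `f` is uniquely ergodic: it has exactly one invariant Borel probability measure. -/
def UniquelyErgodic {X : Type*} [MeasurableSpace X] (f : X → X) : Prop :=
  ∃! μ : Measure X, InvProb f μ

/-- `f` is uniquely ergodic with unique invariant Borel probability measure `μ`. -/
def UniquelyErgodicWith {X : Type*} [MeasurableSpace X] (f : X → X) (μ : Measure X) : Prop :=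
  InvProb f μ ∧ ∀ ν : Measure X, InvProb f ν → ν = μ

/-- `f` is totally uniquely ergodic: every positive power of `f` is uniquely ergodic. -/
def TotallyUniquelyErgodic {X : Type*} [MeasurableSpace X] (f : X → X) : Prop :=
  ∀ n : ℕ, 0 < n → UniquelyErgodic (f^[n])

/-- Topological transitivity. -/
def TopTransitive {X : Type*} [TopologicalSpace X] (f : X → X) : Prop :=
  ∀ U V : Set X, IsOpen U → IsOpen V → U.Nonempty → V.Nonempty →
    ∃ k : ℕ, 0 < k ∧ (f^[k] '' U ∩ V).Nonempty

/-- Total transitivity: every positive power is topologically transitive. -/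
def TotallyTransitive {X : Type*} [TopologicalSpace X] (f : X → X) : Prop :=
  ∀ n : ℕ, 0 < n → TopTransitive (f^[n])

/-- Topological weak mixing: `f × f` is topologically transitive. -/
def TopWeaklyMixing {X : Type*} [TopologicalSpace X] (f : X → X) : Prop :=
  TopTransitive (Prod.map f f)

/-- Topological mixing. -/
def TopMixing {X : Type*} [TopologicalSpace X] (f : X → X) : Prop :=
  ∀ U V : Set X, IsOpen U → IsOpen V → U.Nonempty → V.Nonempty →
    ∃ N : ℕ, 0 < N ∧ ∀ k ≥ N, (f^[k] '' U ∩ V).Nonempty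

/-- Minimality: every forward orbit is dense. -/
def MinimalSys {X : Type*} [TopologicalSpace X] (f : X → X) : Prop :=
  ∀ x : X, Dense (Set.range fun n : ℕ => f^[n] x)

/-- A measurable eigenfunction of `f` whose eigenvalue `ω ≠ 1` is a `d`-th root of unity vanishes
almost everywhere as soon as `f^[p]` is pre-ergodic for all primes `p ∣ d`. -/
theorem ae_eq_zero_of_comp_eq_mul {X : Type*} [MeasurableSpace X] {μ : Measure X} {f : X → X}
    (hf : Measure.QuasiMeasurePreserving f μ μ)
    {d : ℕ} (hd : d ≠ 0) (h : ∀ p : ℕ, p.Prime → p ∣ d → PreErgodic f^[p] μ)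
    {ω : ℂ} (hω : ω ^ d = 1) (hω1 : ω ≠ 1) {E : X → ℂ} (hE : Measurable E)
    (hEf : ∀ x, E (f x) = ω * E x) : E =ᵐ[μ] 0 := by
  obtain ⟨p, hp, hpm⟩ := Nat.exists_prime_and_dvd (n := orderOf ω) (by simpa using hω1)
  obtain ⟨q, hq⟩ := hpm
  have hm : 0 < orderOf ω := orderOf_pos_iff.2 (isOfFinOrder_iff_pow_eq_one.2 ⟨d, by omega, hω⟩)
  have hq0 : q ≠ 0 := by
    rintro rfl
    omega
  have hη1 : ω ^ q ≠ 1 := pow_ne_one_of_lt_orderOf hq0 <| by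
    have := hp.two_le
    rw [hq]
    nlinarith [Nat.pos_of_ne_zero hq0]
  have hfp := h p hp ((Dvd.intro _ hq.symm).trans (orderOf_dvd_of_pow_eq_one hω))
  have hiter (n : ℕ) (x : X) : E (f^[n] x) = ω ^ n * E x := by
    induction n with
    | zero => simp
    | succ n ih => rw [Function.iterate_succ_apply', hEf, ih, pow_succ]; ring
  obtain ⟨c, hc⟩ := hfp.ae_eq_const_of_ae_eq_comp (g := fun x => E x ^ q) (hE.pow_const q) <| by
    ext x
    simp only [Function.comp_apply, hiter, mul_pow]
    rw [← pow_mul, ← hq, pow_orderOf_eq_one, one_mul]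
  filter_upwards [hc, hf.ae hc] with x hx hfx
  simp only [Function.const_apply] at hx hfx
  rw [hEf, mul_pow, hx] at hfx
  have hc0 : c = 0 := by
    by_contra hc0
    exact hη1 (mul_right_cancel₀ hc0 (hfx.trans (one_mul c).symm))
  exact eq_zero_of_pow_eq_zero (n := q) (hx.trans hc0)

/-- If `f` is ergodic and `f^[p]` is pre-ergodic for every prime `p ∣ d`, then `f^[d]` is
ergodic. -/
theorem Ergodic.iterate_of_prime_dvd {X : Type*} [MeasurableSpace X] {μ : Measure X} {f : X → X}
    (hf : Ergodic f μ)
    {d : ℕ} (hd : d ≠ 0) (h : ∀ p : ℕ, p.Prime → p ∣ d → PreErgodic f^[p] μ) :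
    Ergodic f^[d] μ := by
  have hfm := hf.measurable
  refine ⟨hf.toMeasurePreserving.iterate d, ⟨fun s hs hfs => ?_⟩⟩
  set g : X → ℂ := s.indicator fun _ => 1 with hg
  have hgm : Measurable g := measurable_const.indicator hs
  have hgd (x : X) : g (f^[d] x) = g x := by
    change s.indicator (fun _ => (1 : ℂ)) (f^[d] x) = _
    rw [hg, ← Set.indicator_comp_right (f := f^[d]), hfs]
    rfl
  let E (ω : ℂ) (x : X) : ℂ := ∑ k ∈ Finset.range d, ω⁻¹ ^ k * g (f^[k] x)
  have hEm (ω : ℂ) : Measurable (E ω) :=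
    Finset.measurable_sum _ fun k _ => (hgm.comp (hfm.iterate k)).const_mul _
  have hEf {ω : ℂ} (hω : ω ^ d = 1) (x : X) : E ω (f x) = ω * E ω x := by
    have hω0 : ω ≠ 0 := by
      rintro rfl
      simp [hd] at hω
    have h1 := Finset.sum_range_succ (fun k => ω⁻¹ ^ k * g (f^[k] x)) d
    rw [Finset.sum_range_succ', hgd, inv_pow ω d, hω] at h1
    have h2 : E ω x = ∑ k ∈ Finset.range d, ω⁻¹ ^ (k + 1) * g (f^[k + 1] x) := by
      simpa [E] using h1.symm
    rw [h2, Finset.mul_sum]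
    refine Finset.sum_congr rfl fun k _ => ?_
    rw [Function.iterate_succ_apply, pow_succ]
    field_simp
  obtain ⟨ζ, hζ⟩ : ∃ ζ : ℂ, IsPrimitiveRoot ζ d := ⟨_, Complex.isPrimitiveRoot_exp d hd⟩
  have hsum (x : X) : ∑ j ∈ Finset.range d, E (ζ ^ j) x = d * g x := by
    rw [Finset.sum_comm, Finset.sum_eq_single_of_mem 0 (by simpa using Nat.pos_of_ne_zero hd)]
    · simp
    · intro k hk hk0
      have hkd := Finset.mem_range.1 hk
      have hne : (ζ ^ k)⁻¹ ≠ 1 := by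
        simpa using hζ.pow_ne_one_of_pos_of_lt hk0 hkd
      have hgeom := geom_sum_eq hne d
      rw [inv_pow, ← pow_mul, mul_comm k d, pow_mul, hζ.pow_eq_one] at hgeom
      simp only [one_pow, inv_one, sub_self, zero_div] at hgeom
      rw [← Finset.sum_mul]
      simp_rw [← inv_pow] at hgeom ⊢
      simp_rw [← pow_mul, mul_comm _ k]
      simp_rw [← pow_mul] at hgeom
      rw [hgeom, zero_mul]
  have hζd (j : ℕ) : (ζ ^ j) ^ d = 1 := by rw [← pow_mul, mul_comm, pow_mul, hζ.pow_eq_one, one_pow]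
  obtain ⟨c, hc⟩ := hf.ae_eq_const_of_ae_eq_comp (hEm 1) <| funext fun x => by
    simpa using hEf (one_pow d) x
  have hzero : ∀ᵐ x ∂μ, ∀ j ∈ Finset.range d, j ≠ 0 → E (ζ ^ j) x = 0 := by
    refine (Finset.eventually_all _).2 fun j hj => ?_
    by_cases hj0 : j = 0
    · simp [hj0]
    · filter_upwards [ae_eq_zero_of_comp_eq_mul hf.quasiMeasurePreserving hd h (hζd j)
        (hζ.pow_ne_one_of_pos_of_lt hj0 (Finset.mem_range.1 hj)) (hEm _) (hEf (hζd j))] with x hx _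
      exact hx
  refine EventuallyConst.of_indicator_const (c := (1 : ℂ)) ?_ one_ne_zero
  refine eventuallyConst_iff_exists_eventuallyEq.2 ⟨c / d, ?_⟩
  filter_upwards [hc, hzero] with x hx hx0
  have := hsum x
  rw [Finset.sum_eq_single_of_mem 0 (by simpa using Nat.pos_of_ne_zero hd) hx0, pow_zero, hx] at this
  have hd' : (d : ℂ) ≠ 0 := by exact_mod_cast hd
  rw [eq_div_iff hd', mul_comm]
  exact this.symm

/-- The invariant measure of a uniquely ergodic map is ergodic. -/
theorem UniquelyErgodicWith.ergodic {X : Type*} [MeasurableSpace X] {μ : Measure X} {f : X → X}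
    (h : UniquelyErgodicWith f μ) (hf : Measurable f) : Ergodic f μ := by
  refine Ergodic.of_mem_extremePoints ((mem_extremePoints_iff_left).2
    ⟨⟨⟨hf, h.1.2⟩, h.1.1⟩, fun ν hν _ _ _ => h.2 ν ⟨hν.2, hν.1.map_eq⟩⟩)

/-- If `f` is uniquely ergodic, every invariant measure of `f^[d]` is absolutely continuous with
respect to the invariant measure of `f`, since its average over the first `d` images is
`f`-invariant. -/
theorem UniquelyErgodicWith.absolutelyContinuous_of_iterate {X : Type*} [MeasurableSpace X]
    {μ ν : Measure X} {f : X → X} (h : UniquelyErgodicWith f μ) (hf : Measurable f)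
    {d : ℕ} (hd : d ≠ 0) (hν : InvProb f^[d] ν) : ν ≪ μ := by
  have := hν.1
  set κ : Measure X := (d : ℝ≥0∞)⁻¹ • ∑ k ∈ Finset.range d, ν.map f^[k] with hκ
  have hd0 : (d : ℝ≥0∞) ≠ 0 := by exact_mod_cast hd
  have hinv : InvProb f κ := by
    refine ⟨⟨?_⟩, ?_⟩
    · have (k : ℕ) : ν.map f^[k] univ = 1 := by
        rw [Measure.map_apply (hf.iterate k) .univ, preimage_univ, measure_univ]
      simp [hκ, this, ENNReal.inv_mul_cancel hd0]
    · have hmap (k : ℕ) : (ν.map f^[k]).map f = ν.map f^[k + 1] := by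
        rw [Measure.map_map hf (hf.iterate k), Function.iterate_succ']
      rw [hκ, Measure.map_smul, Measure.map_finset_sum hf.aemeasurable]
      simp_rw [hmap]
      congr 1
      have h1 := Finset.sum_range_succ (fun k => ν.map f^[k]) d
      rw [Finset.sum_range_succ', hν.2] at h1
      simp only [Function.iterate_zero, Measure.map_id] at h1
      ext s hs
      have h2 := congrArg (fun ρ : Measure X => ρ s) h1
      simp only [Measure.add_apply] at h2
      exact (ENNReal.add_left_inj (measure_ne_top ν s)).1 h2
  rw [← h.2 κ hinv]
  refine Measure.AbsolutelyContinuous.smul_right ?_ (by simp)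
  refine Measure.absolutelyContinuous_of_le ?_
  calc ν = ν.map f^[0] := by simp
    _ ≤ _ := Finset.single_le_sum (f := fun k => ν.map f^[k]) (fun _ _ => Measure.zero_le _)
      (Finset.mem_range.2 (Nat.pos_of_ne_zero hd))

/-- The invariant measure of a uniquely ergodic `f` is the only invariant measure of `f^[d]` as soon
as it is ergodic for `f^[d]`. -/
theorem UniquelyErgodicWith.iterate_of_ergodic {X : Type*} [MeasurableSpace X]
    {μ : Measure X} {f : X → X} (h : UniquelyErgodicWith f μ) (hf : Measurable f)
    {d : ℕ} (hd : d ≠ 0) (herg : Ergodic f^[d] μ) : UniquelyErgodicWith f^[d] μ := by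
  have := h.1.1
  refine ⟨⟨this, herg.map_eq⟩, fun ν hν => ?_⟩
  have := hν.1
  exact herg.eq_of_absolutelyContinuous ⟨hf.iterate d, hν.2⟩
    (h.absolutelyContinuous_of_iterate hf hd hν)

/-- Proposition 2.13: if `(X,μ,f)` is uniquely ergodic and `f^d` is not uniquely ergodic
for some `d ≥ 2`, then `f^p` is not uniquely ergodic for some prime `p` dividing `d`. -/
theorem not_uniquelyErgodic_pow_prime_dvd
    {X : Type*} [MetricSpace X] [CompactSpace X] [MeasurableSpace X] [BorelSpace X]
    (f : X → X) (hf : IsHomeomorph f) (μ : Measure X) (hue : UniquelyErgodicWith f μ)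
    (d : ℕ) (hd : 2 ≤ d) (hnue : ¬ UniquelyErgodic (f^[d])) :
    ∃ p : ℕ, p.Prime ∧ p ∣ d ∧ ¬ UniquelyErgodic (f^[p]) := by
  have hfm : Measurable f := hf.continuous.measurable
  by_contra! hcon
  have hprime (p : ℕ) (hp : p.Prime) (hpd : p ∣ d) : PreErgodic f^[p] μ := by
    obtain ⟨ν, hν, huniq⟩ := hcon p hp hpd
    have hμ : MeasurePreserving f^[p] μ μ := (MeasurePreserving.mk hfm hue.1.2).iterate p
    obtain rfl := huniq μ ⟨hue.1.1, hμ.map_eq⟩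
    exact (UniquelyErgodicWith.ergodic ⟨hν, huniq⟩ (hfm.iterate p)).toPreErgodic
  have herg := (hue.ergodic hfm).iterate_of_prime_dvd (by omega) hprime
  exact hnue ⟨μ, hue.iterate_of_ergodic hfm (by omega) herg⟩
end
end

section
/- Let (X,μ,f) be uniquely ergodic and suppose (X,μ,f^p) is not uniquely ergodic for some prime p. Then there exists an f^p-ergodic Borel probability measure ν such that ν ∘ f^{-i} ≠ ν ∘ f^{-j} for all 0 ≤ i < j ≤ p−1, the set of f^p-ergodic measures equals {ν ∘ f^{-i} : 0 ≤ i ≤ p−1}, and μ = (1/p) ∑_{i=0}^{p-1} ν ∘ f^{-i}. -/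
open MeasureTheory Filter Topology Set
open scoped ENNReal NNReal

attribute [local instance] Matrix.normedAddCommGroup

noncomputable section

/-- Distinct ergodic probability measures are mutually singular. -/
theorem Ergodic.mutuallySingular_of_ne {X : Type*} [MeasurableSpace X] {g : X → X}
    {η ρ : Measure X} [IsProbabilityMeasure η] [IsProbabilityMeasure ρ]
    (hη : Ergodic g η) (hρ : Ergodic g ρ) (hne : η ≠ ρ) : η ⟂ₘ ρ := by
  have hinv := hη.toMeasurePreserving.singularPart hρ.toMeasurePreserving
  obtain ⟨c, hc⟩ := hη.eq_smul_of_absolutelyContinuous hinv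
    (Measure.absolutelyContinuous_of_le (Measure.singularPart_le η ρ))
  rcases eq_or_ne c 0 with rfl | hc0
  · rw [zero_smul, Measure.singularPart_eq_zero] at hc
    exact absurd (hρ.eq_of_absolutelyContinuous hη.toMeasurePreserving hc) hne
  · have h : c • η ⟂ₘ ρ := hc ▸ Measure.mutuallySingular_singularPart η ρ
    exact h.mono_ac (Measure.absolutelyContinuous_smul hc0) .rfl

theorem MeasureTheory.Measure.map_iterate {X : Type*} [MeasurableSpace X] {f : X → X}
    (hf : Measurable f)
    (ν : Measure X) (n : ℕ) : ν.map f^[n] = (Measure.map f)^[n] ν := by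
  induction n with
  | zero => simp
  | succ n ih =>
    rw [Function.iterate_succ', Function.iterate_succ_apply', ← ih,
      Measure.map_map hf (hf.iterate n)]

/-- The conditional measure on an invariant set is invariant. -/
theorem MeasureTheory.MeasurePreserving.cond {X : Type*} [MeasurableSpace X]
    {g : X → X} {μ : Measure X}
    (hg : MeasurePreserving g μ μ) {s : Set X} (hs : MeasurableSet s) (hgs : g ⁻¹' s = s) :
    MeasurePreserving g (ProbabilityTheory.cond μ s) (ProbabilityTheory.cond μ s) := by
  have h := hg.restrict_preimage hs
  rw [hgs] at h
  exact h.smul_measure _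

section UniquelyErgodicWith

variable {X : Type*} [MeasurableSpace X] {f : X → X} {μ : Measure X} {p : ℕ}

theorem UniquelyErgodicWith.eq_average (hue : UniquelyErgodicWith f μ) (hf : Measurable f)
    (hp : p ≠ 0) {ρ : Measure X} [IsProbabilityMeasure ρ] (hρ : MeasurePreserving f^[p] ρ ρ) :
    μ = (p : ℝ≥0∞)⁻¹ • ∑ i ∈ Finset.range p, ρ.map f^[i] := by
  refine (hue.2 _ ⟨⟨?_⟩, ?_⟩).symm
  · have h (i : ℕ) : ρ.map f^[i] univ = 1 := by
      rw [Measure.map_apply (hf.iterate i) .univ, preimage_univ, measure_univ]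
    simp [h, ENNReal.inv_mul_cancel, hp]
  · rw [Measure.map_smul, ← Measure.mapₗ_apply_of_measurable hf, map_sum]
    simp_rw [Measure.mapₗ_apply_of_measurable hf, Measure.map_map hf (hf.iterate _),
      ← Function.iterate_succ']
    congr 1
    have h := Finset.sum_range_succ (fun i => ρ.map f^[i]) p
    rw [Finset.sum_range_succ', hρ.map_eq, Function.iterate_zero, Measure.map_id] at h
    ext s hs
    have h' := congrArg (fun m : Measure X => m s) h
    simp only [Measure.add_apply] at h'
    exact (ENNReal.add_left_inj (measure_ne_top ρ s)).1 h'

theorem UniquelyErgodicWith.absolutelyContinuous (hue : UniquelyErgodicWith f μ)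
    (hf : Measurable f) (hp : p ≠ 0) {ρ : Measure X} [IsProbabilityMeasure ρ]
    (hρ : MeasurePreserving f^[p] ρ ρ) : ρ ≪ μ := by
  rw [hue.eq_average hf hp hρ]
  refine Measure.AbsolutelyContinuous.trans ?_ (Measure.absolutelyContinuous_smul (by simp))
  refine Measure.absolutelyContinuous_of_le ?_
  simpa using Finset.single_le_sum (f := fun i => ρ.map f^[i]) (fun _ _ => Measure.zero_le _)
    (Finset.mem_range.2 (Nat.pos_of_ne_zero hp))

/-- A non-null set invariant under `f^[p]` has measure at least `1 / p`. -/
theorem UniquelyErgodicWith.inv_le_measure (hue : UniquelyErgodicWith f μ) (hf : Measurable f)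
    (hp : p ≠ 0) {s : Set X} (hs : MeasurableSet s) (hfs : f^[p] ⁻¹' s = s) (h0 : μ s ≠ 0) :
    (p : ℝ≥0∞)⁻¹ ≤ μ s := by
  have := hue.1.1
  have hμ : MeasurePreserving f μ μ := ⟨hf, hue.1.2⟩
  have := ProbabilityTheory.cond_isProbabilityMeasure h0
  have hc := (hμ.iterate p).cond hs hfs
  rw [hue.eq_average hf hp hc, Measure.smul_apply, smul_eq_mul]
  refine le_mul_of_one_le_right' ?_
  have hle := Finset.single_le_sum (f := fun i => (ProbabilityTheory.cond μ s).map f^[i])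
    (fun _ _ => Measure.zero_le _) (Finset.mem_range.2 (Nat.pos_of_ne_zero hp))
  refine le_trans ?_ (hle s)
  simp [ProbabilityTheory.cond_apply_self, h0]

theorem UniquelyErgodicWith.exists_ergodic_iterate (hue : UniquelyErgodicWith f μ)
    (hf : Measurable f) (hp : p ≠ 0) :
    ∃ ν : Measure X, IsProbabilityMeasure ν ∧ Ergodic f^[p] ν := by
  have := hue.1.1
  have hμ : MeasurePreserving f μ μ := ⟨hf, hue.1.2⟩
  let S : Set (Set X) := {s | MeasurableSet s ∧ f^[p] ⁻¹' s = s ∧ μ s ≠ 0}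
  have hS : (univ : Set X) ∈ S := ⟨.univ, preimage_univ, by simp⟩
  have hfin : ⨅ s ∈ S, μ s ≠ ∞ := ne_top_of_le_ne_top (measure_ne_top μ univ) (iInf₂_le _ hS)
  obtain ⟨s, ⟨hs, hfs, h0⟩, hlt⟩ : ∃ s ∈ S, μ s < (⨅ s ∈ S, μ s) + (p : ℝ≥0∞)⁻¹ := by
    have := ENNReal.lt_add_right hfin (b := (p : ℝ≥0∞)⁻¹) (by simp)
    simpa only [iInf_lt_iff, exists_prop] using this
  refine ⟨ProbabilityTheory.cond μ s, ProbabilityTheory.cond_isProbabilityMeasure h0,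
    (hμ.iterate p).cond hs hfs, ⟨fun t ht hft => ?_⟩⟩
  have hinter : μ (s ∩ t) = 0 ∨ μ (s \ t) = 0 := by
    by_contra! h
    have h₁ : ⨅ s ∈ S, μ s ≤ μ (s ∩ t) :=
      iInf₂_le _ ⟨hs.inter ht, by rw [preimage_inter, hfs, hft], h.1⟩
    have h₂ := hue.inv_le_measure hf hp (hs.diff ht) (by rw [preimage_sdiff, hfs, hft]) h.2
    rw [← measure_inter_add_sdiff s ht] at hlt
    exact hlt.not_ge (add_le_add h₁ h₂)
  rw [eventuallyConst_set', ae_eq_empty, ae_eq_univ, ProbabilityTheory.cond_apply hs,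
    ProbabilityTheory.cond_apply hs, ← sdiff_eq]
  exact hinter.imp (by simp [·]) (by simp [·])

end UniquelyErgodicWith

/-- Lemma 2.14: if `(X,μ,f)` is uniquely ergodic and `f^p` is not uniquely ergodic for a
prime `p`, then the `f^p`-ergodic measures are exactly the `p` pairwise distinct
pushforwards `ν ∘ f^{-i}`, `0 ≤ i ≤ p-1`, of a single `f^p`-ergodic measure `ν`, and `μ` is
their average. -/
theorem ergodic_measures_of_prime_pow_eq_orbit
    {X : Type*} [MetricSpace X] [CompactSpace X] [MeasurableSpace X] [BorelSpace X]
    (f : X → X) (hf : IsHomeomorph f) (μ : Measure X) (hue : UniquelyErgodicWith f μ)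
    (p : ℕ) (hp : p.Prime) (hnue : ¬ UniquelyErgodic (f^[p])) :
    ∃ ν : Measure X, IsProbabilityMeasure ν ∧ Ergodic (f^[p]) ν ∧
      (∀ i j : ℕ, i < j → j ≤ p - 1 → ν.map (f^[i]) ≠ ν.map (f^[j])) ∧
      {ρ : Measure X | IsProbabilityMeasure ρ ∧ Ergodic (f^[p]) ρ} =
        {ρ : Measure X | ∃ i < p, ρ = ν.map (f^[i])} ∧
      μ = ((p : ℝ≥0∞))⁻¹ • ∑ i ∈ Finset.range p, ν.map (f^[i]) := by
  have hfm : Measurable f := hf.continuous.measurable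
  obtain ⟨ν, hν, hνe⟩ := hue.exists_ergodic_iterate hfm hp.ne_zero
  have hprob (i : ℕ) : IsProbabilityMeasure (ν.map f^[i]) :=
    Measure.isProbabilityMeasure_map (hfm.iterate i).aemeasurable
  have herg (i : ℕ) : Ergodic f^[p] (ν.map f^[i]) :=
    ((hfm.iterate i).measurePreserving ν).ergodic_of_ergodic_semiconj hνe (hfm.iterate p)
      (Function.Commute.iterate_iterate_self f i p)
  have havg := hue.eq_average hfm hp.ne_zero hνe.toMeasurePreserving
  have hper : Function.IsPeriodicPt (Measure.map f) p ν := by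
    rw [Function.IsPeriodicPt, Function.IsFixedPt, ← Measure.map_iterate hfm, hνe.map_eq]
  have hfix : ¬ Function.IsFixedPt (Measure.map f) ν := by
    intro h
    obtain rfl := hue.2 ν ⟨hν, h⟩
    refine hnue ⟨ν, ⟨hν, hνe.map_eq⟩, fun ρ ⟨hρ, hρm⟩ => ?_⟩
    have hρi : MeasurePreserving f^[p] ρ ρ := ⟨hfm.iterate p, hρm⟩
    exact hνe.eq_of_absolutelyContinuous hρi (hue.absolutelyContinuous hfm hp.ne_zero hρi)
  have hmin : Function.minimalPeriod (Measure.map f) ν = p :=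
    (hp.eq_one_or_self_of_dvd _ hper.minimalPeriod_dvd).resolve_left fun h =>
      hfix (Function.minimalPeriod_eq_one_iff_isFixedPt.1 h)
  refine ⟨ν, hν, hνe, fun i j hij hj heq => ?_, ?_, havg⟩
  · rw [Measure.map_iterate hfm, Measure.map_iterate hfm] at heq
    have hpos := hp.pos
    exact hij.ne (Function.iterate_injOn_Iio_minimalPeriod (f := Measure.map f) (x := ν)
      (mem_Iio.2 (by omega)) (mem_Iio.2 (by omega)) heq)
  · ext ρ
    refine ⟨fun ⟨hρ, hρe⟩ => ?_, ?_⟩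
    · by_contra! hne
      have hac := hue.absolutelyContinuous hfm hp.ne_zero hρe.toMeasurePreserving
      have hsing : ρ ⟂ₘ μ := by
        rw [havg, ← Measure.sum_coe_finset]
        refine Measure.MutuallySingular.mono_ac (Measure.MutuallySingular.sum_right.2 fun i => ?_)
          .rfl Measure.smul_absolutelyContinuous
        exact hρe.mutuallySingular_of_ne (herg i) fun h => hne ⟨i, Finset.mem_range.1 i.2, h⟩
      exact IsProbabilityMeasure.ne_zero ρ
        (Measure.eq_zero_of_absolutelyContinuous_of_mutuallySingular hac hsing)
    · rintro ⟨i, -, rfl⟩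
      exact ⟨hprob i, herg i⟩
end
end
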